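/- arXiv:2211.11473 — 2 statements merged into one kernel-verified Lean document; each statement's English description precedes it below -/
import Mathlib

section
/- Let (E, F) be a resistance form on a set X whose resistance metric R is complete and such that (X,R) is doubling and uniformly perfect. Then: (a) (E,F) is regular, i.e., F ∩ C₀(X,R) is dense in C₀(X,R) with respect to the supremum norm, where C₀(X,R) is the space of continuous real-valued functions on (X,R) with compact support; and (b) (E,F) satisfies the annulus comparable condition: there exist α>1 and C>0 such that 𝓡(x, (X∖B_R(x,r)) ∩ cl(B_R(x,αr))) ≤ C·𝓡(x, X∖B_R(x,r)) for every x ∈ X and r > 0. -/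
open Filter Set Metric
open scoped ENNReal Topology

/-- A resistance form `(E, F)` on a set `X` (Kigami):
`F` is a linear subspace of the real-valued functions on `X`, `E` is a nonnegative
symmetric bilinear form on `F` such that (RF1) constants belong to `F` and
`E(u,u) = 0` iff `u` is constant, (RF2) the quotient of `F` by the constants is a
Hilbert space under `E` (stated as completeness of the `E`-seminorm on `F`),
(RF3) points of `X` are separated by `F`, (RF4) for `x ≠ y` the quantity
`R(x,y) = (inf {E(u,u) : u ∈ F, u x = 1, u y = 0})⁻¹` is finite (i.e. the infimum
is positive; an admissible `u` always exists), and (RF5) the Markov property holds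
for the unit truncation. -/
structure ResistanceForm (X : Type*) where
  F : Set (X → ℝ)
  E : (X → ℝ) → (X → ℝ) → ℝ
  zero_mem : (0 : X → ℝ) ∈ F
  add_mem : ∀ {u v : X → ℝ}, u ∈ F → v ∈ F → u + v ∈ F
  smul_mem : ∀ (c : ℝ) {u : X → ℝ}, u ∈ F → c • u ∈ F
  const_mem : ∀ c : ℝ, (fun _ => c) ∈ F
  symm : ∀ u ∈ F, ∀ v ∈ F, E u v = E v u
  add_left : ∀ u ∈ F, ∀ v ∈ F, ∀ w ∈ F, E (u + v) w = E u w + E v w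
  smul_left : ∀ (c : ℝ), ∀ u ∈ F, ∀ v ∈ F, E (c • u) v = c * E u v
  nonneg : ∀ u ∈ F, 0 ≤ E u u
  null_iff_const : ∀ u ∈ F, (E u u = 0 ↔ ∃ c : ℝ, ∀ x, u x = c)
  complete : ∀ u : ℕ → (X → ℝ), (∀ n, u n ∈ F) →
    (∀ ε : ℝ, 0 < ε → ∃ N : ℕ, ∀ m ≥ N, ∀ n ≥ N, E (u m - u n) (u m - u n) < ε) →
    ∃ v ∈ F, ∀ ε : ℝ, 0 < ε → ∃ N : ℕ, ∀ n ≥ N, E (v - u n) (v - u n) < ε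
  sep : ∀ x y : X, x ≠ y → ∃ u ∈ F, u x ≠ u y
  exists_unit : ∀ x y : X, x ≠ y → ∃ u ∈ F, u x = 1 ∧ u y = 0
  inf_pos : ∀ x y : X, x ≠ y →
    0 < sInf {e : ℝ | ∃ u ∈ F, u x = 1 ∧ u y = 0 ∧ E u u = e}
  markov : ∀ u ∈ F, (fun x => max 0 (min 1 (u x))) ∈ F ∧
    E (fun x => max 0 (min 1 (u x))) (fun x => max 0 (min 1 (u x))) ≤ E u u

namespace ResistanceForm

variable {X : Type*}

open Classical in
/-- The resistance metric `R` associated with a resistance form: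
`R(x,x) = 0` and `R(x,y) = (inf {E(u,u) : u ∈ F, u x = 1, u y = 0})⁻¹` for `x ≠ y`. -/
noncomputable def rmetric (rf : ResistanceForm X) (x y : X) : ℝ :=
  if x = y then 0
  else (sInf {e : ℝ | ∃ u ∈ rf.F, u x = 1 ∧ u y = 0 ∧ rf.E u u = e})⁻¹

open Classical in
/-- The resistance `𝓡(A,B)` between two sets: the reciprocal of the minimal energy of
functions that are `≡ 1` on `A` and `≡ 0` on `B` if such functions exist, `0` if no
such function exists, and `∞` if `A` or `B` is empty. -/
noncomputable def setRes (rf : ResistanceForm X) (A B : Set X) : ℝ≥0∞ :=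
  if A.Nonempty ∧ B.Nonempty then
    (if ∃ u ∈ rf.F, (∀ x ∈ A, u x = 1) ∧ (∀ x ∈ B, u x = 0) then
      (ENNReal.ofReal
        (sInf {e : ℝ | ∃ u ∈ rf.F, (∀ x ∈ A, u x = 1) ∧ (∀ x ∈ B, u x = 0) ∧ rf.E u u = e}))⁻¹
    else 0)
  else ⊤

end ResistanceForm

/-- A distance function `ρ` on `X` is doubling: there is `N ∈ ℕ` such that every ball of
radius `2r` is covered by `N` balls of radius `r`. -/
def DoublingOf {X : Type*} (ρ : X → X → ℝ) : Prop :=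
  ∃ N : ℕ, ∀ (x : X) (r : ℝ), ∃ s : Finset X, s.card ≤ N ∧
    {y : X | ρ x y < 2 * r} ⊆ ⋃ z ∈ s, {y : X | ρ z y < r}

/-- A distance function `ρ` on `X` is uniformly perfect: there is `γ > 1` such that
`B(x, γ r) \ B(x, r) ≠ ∅` whenever `B(x,r)` is not the whole space. -/
def UniformlyPerfectOf {X : Type*} (ρ : X → X → ℝ) : Prop :=
  ∃ γ : ℝ, 1 < γ ∧ ∀ (x : X) (r : ℝ), 0 < r → {y : X | ρ x y < r} ≠ Set.univ →
    ({y : X | ρ x y < γ * r} \ {y : X | ρ x y < r}).Nonempty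

namespace ResistanceForm

variable {X : Type*}

lemma sub_mem (rf : ResistanceForm X) {u v : X → ℝ} (hu : u ∈ rf.F) (hv : v ∈ rf.F) :
    u - v ∈ rf.F := by
  have h := rf.add_mem hu (rf.smul_mem (-1) hv)
  have e : u - v = u + (-1 : ℝ) • v := by ext x; simp [sub_eq_add_neg]
  rw [e]; exact h

lemma E_smul (rf : ResistanceForm X) (c : ℝ) {u : X → ℝ} (hu : u ∈ rf.F) :
    rf.E (c • u) (c • u) = c ^ 2 * rf.E u u := by
  have h := rf.smul_mem c hu
  rw [rf.smul_left c u hu _ h, rf.symm u hu _ h, rf.smul_left c u hu u hu]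
  ring

lemma E_add (rf : ResistanceForm X) {u v : X → ℝ} (hu : u ∈ rf.F) (hv : v ∈ rf.F) :
    rf.E (u + v) (u + v) = rf.E u u + 2 * rf.E u v + rf.E v v := by
  have h := rf.add_mem hu hv
  rw [rf.add_left u hu v hv _ h, rf.symm u hu _ h, rf.symm v hv _ h,
    rf.add_left u hu v hv u hu, rf.add_left u hu v hv v hv, rf.symm v hv u hu]
  ring

lemma E_cs (rf : ResistanceForm X) {u v : X → ℝ} (hu : u ∈ rf.F) (hv : v ∈ rf.F) :
    rf.E u v ^ 2 ≤ rf.E u u * rf.E v v := by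
  have h : ∀ t : ℝ, 0 ≤ rf.E u u * (t * t) + (2 * rf.E u v) * t + rf.E v v := by
    intro t
    have h1 := rf.smul_mem t hu
    have h2 := rf.nonneg _ (rf.add_mem h1 hv)
    rw [rf.E_add h1 hv, rf.E_smul t hu, rf.smul_left t u hu v hv] at h2
    nlinarith
  have := discrim_le_zero h
  unfold discrim at this
  nlinarith

lemma E_tri (rf : ResistanceForm X) {u v : X → ℝ} (hu : u ∈ rf.F) (hv : v ∈ rf.F)
    {a b : ℝ} (ha : 0 ≤ a) (hb : 0 ≤ b) (hua : rf.E u u ≤ a ^ 2) (hvb : rf.E v v ≤ b ^ 2) :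
    rf.E (u + v) (u + v) ≤ (a + b) ^ 2 := by
  have h1 : rf.E u v ^ 2 ≤ (a * b) ^ 2 := by
    rw [mul_pow]
    exact (rf.E_cs hu hv).trans
      (mul_le_mul hua hvb (rf.nonneg v hv) (by positivity))
  have h2 := (abs_le_of_sq_le_sq' h1 (by positivity)).2
  rw [rf.E_add hu hv]
  nlinarith

lemma E_const (rf : ResistanceForm X) (c : ℝ) : rf.E (fun _ => c) (fun _ => c) = 0 :=
  (rf.null_iff_const _ (rf.const_mem c)).2 ⟨c, fun _ => rfl⟩

lemma add_const_mem (rf : ResistanceForm X) {u : X → ℝ} (hu : u ∈ rf.F) (c : ℝ) :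
    (fun x => u x + c) ∈ rf.F := rf.add_mem hu (rf.const_mem c)

lemma E_add_const (rf : ResistanceForm X) {u : X → ℝ} (hu : u ∈ rf.F) (c : ℝ) :
    rf.E (fun x => u x + c) (fun x => u x + c) ≤ rf.E u u := by
  have h := rf.E_tri hu (rf.const_mem c) (Real.sqrt_nonneg (rf.E u u)) le_rfl
    (by rw [Real.sq_sqrt (rf.nonneg u hu)]) (by rw [rf.E_const]; simp)
  rw [add_zero, Real.sq_sqrt (rf.nonneg u hu)] at h
  exact h

lemma sum_mem (rf : ResistanceForm X) {ι : Type*} (s : Finset ι) (f : ι → X → ℝ)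
    (hf : ∀ i ∈ s, f i ∈ rf.F) : ∑ i ∈ s, f i ∈ rf.F := by
  classical
  induction s using Finset.induction_on with
  | empty => simpa using rf.zero_mem
  | insert a s ha ih =>
    rw [Finset.sum_insert ha]
    exact rf.add_mem (hf a (by simp)) (ih fun i hi => hf i (by simp [hi]))

lemma E_zero (rf : ResistanceForm X) : rf.E 0 0 = 0 := rf.E_const 0

lemma E_sum (rf : ResistanceForm X) {ι : Type*} (s : Finset ι) (f : ι → X → ℝ) (a : ι → ℝ)
    (hf : ∀ i ∈ s, f i ∈ rf.F) (ha : ∀ i ∈ s, 0 ≤ a i)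
    (hE : ∀ i ∈ s, rf.E (f i) (f i) ≤ a i ^ 2) :
    rf.E (∑ i ∈ s, f i) (∑ i ∈ s, f i) ≤ (∑ i ∈ s, a i) ^ 2 := by
  classical
  induction s using Finset.induction_on with
  | empty => simp [rf.E_zero]
  | insert b s hb ih =>
    rw [Finset.sum_insert hb, Finset.sum_insert hb]
    have hf' : ∀ i ∈ s, f i ∈ rf.F := fun i hi => hf i (by simp [hi])
    have ha' : ∀ i ∈ s, 0 ≤ a i := fun i hi => ha i (by simp [hi])
    exact rf.E_tri (hf b (by simp)) (rf.sum_mem s f hf') (ha b (by simp))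
      (Finset.sum_nonneg ha') (hE b (by simp))
      (ih hf' ha' fun i hi => hE i (by simp [hi]))

/-- bounded positive part -/
lemma posPart_mem (rf : ResistanceForm X) {u : X → ℝ} (hu : u ∈ rf.F) {c : ℝ} (hc : 0 < c)
    (hb : ∀ x, u x ≤ c) : (fun x => max 0 (u x)) ∈ rf.F := by
  have h := rf.smul_mem c (rf.markov _ (rf.smul_mem c⁻¹ hu)).1
  convert h using 1
  ext x
  have h1 : c⁻¹ * u x ≤ 1 := by
    rw [inv_mul_le_iff₀ hc]; simpa using hb x
  simp only [Pi.smul_apply, smul_eq_mul]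
  rw [min_eq_right h1, mul_max_of_nonneg _ _ hc.le, mul_zero, mul_inv_cancel_left₀ hc.ne']

lemma max_mem (rf : ResistanceForm X) {u v : X → ℝ} (hu : u ∈ rf.F) (hv : v ∈ rf.F) {c d : ℝ}
    (hub : ∀ x, 0 ≤ u x ∧ u x ≤ c) (hvb : ∀ x, 0 ≤ v x ∧ v x ≤ d) :
    (fun x => max (u x) (v x)) ∈ rf.F := by
  have h := rf.add_mem hu (rf.posPart_mem (rf.sub_mem hv hu) (c := |d| + 1) (by positivity)
    (fun x => by
      have := hub x; have := hvb x; have := le_abs_self d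
      simp only [Pi.sub_apply]; linarith))
  convert h using 1
  ext x
  simp only [Pi.add_apply, Pi.sub_apply]
  rw [← max_add_add_left]; simp

section metric
variable [MetricSpace X]

lemma rdist (rf : ResistanceForm X) (hR : ∀ x y : X, dist x y = rf.rmetric x y)
    {x y : X} (h : x ≠ y) :
    sInf {e : ℝ | ∃ u ∈ rf.F, u x = 1 ∧ u y = 0 ∧ rf.E u u = e} = (dist x y)⁻¹ := by
  rw [hR, rmetric, if_neg h, inv_inv]

lemma sq_le (rf : ResistanceForm X) (hR : ∀ x y : X, dist x y = rf.rmetric x y)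
    {u : X → ℝ} (hu : u ∈ rf.F) (x y : X) :
    (u x - u y) ^ 2 ≤ dist x y * rf.E u u := by
  by_cases hxy : u x = u y
  · rw [hxy]; simpa using mul_nonneg dist_nonneg (rf.nonneg u hu)
  have hne : x ≠ y := fun h => hxy (by rw [h])
  have hd : u x - u y ≠ 0 := sub_ne_zero.2 hxy
  have hm := rf.smul_mem (u x - u y)⁻¹ (rf.add_const_mem hu (-u y))
  have hle : (dist x y)⁻¹ ≤ ((u x - u y)⁻¹) ^ 2 * rf.E u u := by
    rw [← rf.rdist hR hne]
    refine le_trans (csInf_le ⟨0, ?_⟩ ⟨_, hm, ?_, ?_, rfl⟩) ?_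
    · rintro e ⟨u, hu, -, -, rfl⟩; exact rf.nonneg u hu
    · simp only [Pi.smul_apply, smul_eq_mul, ← sub_eq_add_neg]; exact inv_mul_cancel₀ hd
    · simp
    · rw [rf.E_smul _ (rf.add_const_mem hu (-u y))]
      exact mul_le_mul_of_nonneg_left (rf.E_add_const hu _) (by positivity)
  have hdp := dist_pos.2 hne
  have h2 : 0 < (u x - u y) ^ 2 := by positivity
  rw [inv_le_iff_one_le_mul₀ hdp] at hle
  have := mul_le_mul_of_nonneg_left hle h2.le
  have e : (u x - u y) ^ 2 * ((u x - u y)⁻¹ ^ 2 * rf.E u u * dist x y)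
      = dist x y * rf.E u u := by field_simp
  rw [e] at this; linarith

lemma cont (rf : ResistanceForm X) (hR : ∀ x y : X, dist x y = rf.rmetric x y)
    {u : X → ℝ} (hu : u ∈ rf.F) : Continuous u := by
  rw [continuous_iff_continuousAt]
  intro x
  rw [ContinuousAt, tendsto_iff_dist_tendsto_zero]
  have h : Tendsto (fun y => Real.sqrt (dist y x * rf.E u u)) (𝓝 x) (𝓝 0) := by
    have : Continuous fun y => Real.sqrt (dist y x * rf.E u u) := by fun_prop
    simpa using this.tendsto x
  refine squeeze_zero (fun _ => dist_nonneg) (fun y => ?_) h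
  rw [Real.dist_eq]
  exact Real.abs_le_sqrt (rf.sq_le hR hu y x)

/-- two-point separation: `f x = 0`, `f = 1` on a ball around `z`. -/
lemma two_point (rf : ResistanceForm X) (hR : ∀ x y : X, dist x y = rf.rmetric x y)
    {x z : X} {s : ℝ} (hs : 0 < s) (hz : 15 / 16 * s ≤ dist z x) :
    ∃ f ∈ rf.F, f x = 0 ∧ (∀ y, 0 ≤ f y) ∧ (∀ y, dist z y < s / 16 → f y = 1) ∧
      rf.E f f ≤ 16 / s := by
  have hd : 0 < dist z x := lt_of_lt_of_le (by positivity) hz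
  have hne : z ≠ x := dist_pos.1 hd
  obtain ⟨u0, hu0, h0⟩ := rf.exists_unit z x hne
  obtain ⟨e, ⟨u, hu, huz, hux, rfl⟩, he⟩ := exists_lt_of_csInf_lt
    (s := {e : ℝ | ∃ u ∈ rf.F, u z = 1 ∧ u x = 0 ∧ rf.E u u = e})
    ⟨_, u0, hu0, h0.1, h0.2, rfl⟩ (b := 2 / dist z x)
    (by rw [rf.rdist hR hne, inv_eq_one_div]; gcongr; norm_num)
  have hE : rf.E u u ≤ 4 / s := by
    refine he.le.trans ?_
    rw [div_le_div_iff₀ hd hs]; linarith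
  have hm := rf.markov _ (rf.smul_mem 2 hu)
  refine ⟨_, hm.1, by simp [hux], fun y => le_max_left _ _, fun y hy => ?_, ?_⟩
  · have h1 := rf.sq_le hR hu z y
    have h2 : dist z y * rf.E u u ≤ s / 16 * (4 / s) :=
      mul_le_mul hy.le hE (rf.nonneg u hu) (by positivity)
    have h3 : s / 16 * (4 / s) = 1 / 4 := by field_simp; norm_num
    rw [huz] at h1
    have h4 : 1 / 2 ≤ u y := by nlinarith
    have h5 : (1 : ℝ) ≤ 2 * u y := by linarith
    simp [h5]
  · refine hm.2.trans ?_
    rw [rf.E_smul 2 hu]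
    have : (16 : ℝ) / s = 2 ^ 2 * (4 / s) := by ring
    rw [this]; gcongr

end metric

end ResistanceForm

section cover
variable {X : Type*} [MetricSpace X]

lemma cover_iter {N : ℕ} (h : ∀ (x : X) (r : ℝ), ∃ s : Finset X, s.card ≤ N ∧
    {y : X | dist x y < 2 * r} ⊆ ⋃ z ∈ s, {y : X | dist z y < r}) (j : ℕ) :
    ∀ (x : X) (r : ℝ), ∃ s : Finset X, s.card ≤ N ^ j ∧
      ∀ y, dist x y < 2 ^ j * r → ∃ z ∈ s, dist z y < r := by
  classical
  induction j with
  | zero => intro x r; exact ⟨{x}, by simp, fun y hy => ⟨x, by simp, by simpa using hy⟩⟩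
  | succ j ih =>
    intro x r
    obtain ⟨s, hs, hc⟩ := ih x (2 * r)
    choose t ht htc using h
    refine ⟨s.biUnion fun z => t z r, ?_, fun y hy => ?_⟩
    · rw [pow_succ]
      exact (Finset.card_biUnion_le_card_mul s _ N fun z _ => ht z r).trans
        (Nat.mul_le_mul_right _ hs)
    · obtain ⟨z, hz, hzy⟩ := hc y (by rw [pow_succ] at hy; linarith)
      obtain ⟨w, hw, hwy⟩ := mem_iUnion₂.1 (htc z r hzy)
      exact ⟨w, Finset.mem_biUnion.2 ⟨z, hz, hw⟩, hwy⟩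

lemma compact_closedBall [CompleteSpace X] (hdb : DoublingOf fun x y : X => dist x y)
    (x : X) (r : ℝ) : IsCompact (Metric.closedBall x r) := by
  obtain ⟨N, hN⟩ := hdb
  refine TotallyBounded.isCompact_of_isClosed ?_ isClosed_closedBall
  rw [Metric.totallyBounded_iff]
  intro ε hε
  obtain ⟨j, hj⟩ := pow_unbounded_of_one_lt (r / ε) (one_lt_two : (1 : ℝ) < 2)
  obtain ⟨s, -, hs⟩ := cover_iter hN j x ε
  refine ⟨s, s.finite_toSet, fun y hy => ?_⟩
  rw [div_lt_iff₀ hε] at hj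
  obtain ⟨z, hz, hzy⟩ := hs y (by rw [dist_comm]; exact (mem_closedBall.1 hy).trans_lt hj)
  exact mem_iUnion₂.2 ⟨z, hz, by rw [mem_ball, dist_comm]; exact hzy⟩

end cover

namespace ResistanceForm
section metric2
variable {X : Type*} [MetricSpace X]

/-- function vanishing at `x` and at least one on an annulus -/
lemma annulus (rf : ResistanceForm X) (hR : ∀ x y : X, dist x y = rf.rmetric x y)
    {N : ℕ} (h : ∀ (x : X) (r : ℝ), ∃ s : Finset X, s.card ≤ N ∧
    {y : X | dist x y < 2 * r} ⊆ ⋃ z ∈ s, {y : X | dist z y < r}) (x : X) {s : ℝ} (hs : 0 < s) :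
    ∃ f ∈ rf.F, f x = 0 ∧ (∀ y, 0 ≤ f y) ∧ (∀ y, s ≤ dist x y → dist x y < 4 * s → 1 ≤ f y) ∧
      rf.E f f ≤ ((N ^ 6 : ℕ) * (4 / Real.sqrt s)) ^ 2 := by
  classical
  obtain ⟨t, ht, hc⟩ := cover_iter h 6 x (s / 16)
  have key : ∀ z : X, ∃ f ∈ rf.F, f x = 0 ∧ (∀ y, 0 ≤ f y) ∧
      (15 / 16 * s ≤ dist z x → ∀ y, dist z y < s / 16 → f y = 1) ∧
      rf.E f f ≤ (4 / Real.sqrt s) ^ 2 := by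
    intro z
    have e : (4 / Real.sqrt s) ^ 2 = 16 / s := by
      rw [div_pow, Real.sq_sqrt hs.le]; norm_num
    rw [e]
    by_cases hz : 15 / 16 * s ≤ dist z x
    · obtain ⟨f, h1, h2, h3, h4, h5⟩ := rf.two_point hR hs hz
      exact ⟨f, h1, h2, h3, fun _ => h4, h5⟩
    · exact ⟨0, rf.zero_mem, rfl, fun _ => le_rfl, fun h => absurd h hz, by
        rw [rf.E_zero]; positivity⟩
  choose f hfF hfx hf0 hf1 hfE using key
  refine ⟨∑ z ∈ t, f z, rf.sum_mem t f fun i _ => hfF i, ?_, ?_, ?_, ?_⟩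
  · simp [hfx]
  · intro y; rw [Finset.sum_apply]; exact Finset.sum_nonneg fun i _ => hf0 i y
  · intro y hy1 hy2
    obtain ⟨z, hz, hzy⟩ := hc y (by norm_num; linarith)
    rw [Finset.sum_apply]
    have : f z y = 1 := hf1 z (by
      have := dist_triangle x z y
      rw [dist_comm x z] at this; linarith) y hzy
    rw [← this]
    exact Finset.single_le_sum (f := fun i => f i y) (fun i _ => hf0 i y) hz
  · have := rf.E_sum t f (fun _ => 4 / Real.sqrt s) (fun i _ => hfF i)
      (fun _ _ => by positivity) (fun i _ => hfE i)
    refine this.trans ?_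
    rw [Finset.sum_const, nsmul_eq_mul]
    have : (t.card : ℝ) ≤ (N ^ 6 : ℕ) := by exact_mod_cast ht
    gcongr

lemma cutoff (rf : ResistanceForm X) (hR : ∀ x y : X, dist x y = rf.rmetric x y)
    (hdb : DoublingOf fun x y : X => dist x y) :
    ∃ C : ℝ, 0 < C ∧ ∀ (x : X) (r : ℝ), 0 < r → ∃ g ∈ rf.F, g x = 0 ∧
      (∀ y, 0 ≤ g y ∧ g y ≤ 1) ∧ (∀ y, r ≤ dist x y → g y = 1) ∧ rf.E g g ≤ C / r := by
  obtain ⟨N, hN⟩ := hdb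
  set M : ℝ := ((N ^ 6 : ℕ) : ℝ) + 1 with hM
  have hMp : 0 < M := by positivity
  refine ⟨(12 * M) ^ 2, by positivity, fun x r hr => ?_⟩
  set c : ℝ := 4 * M / Real.sqrt r with hc
  have hsr : 0 < Real.sqrt r := Real.sqrt_pos.2 hr
  have hcp : 0 < c := by positivity
  have key : ∀ k : ℕ, ∃ f ∈ rf.F, f x = 0 ∧ (∀ y, 0 ≤ f y) ∧
      (∀ y, 4 ^ k * r ≤ dist x y → dist x y < 4 * (4 ^ k * r) → 1 ≤ f y) ∧
      rf.E f f ≤ (c / 2 ^ k) ^ 2 := by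
    intro k
    obtain ⟨f, h1, h2, h3, h4, h5⟩ := rf.annulus hR hN x (s := 4 ^ k * r) (by positivity)
    refine ⟨f, h1, h2, h3, h4, h5.trans ?_⟩
    have e : Real.sqrt (4 ^ k * r) = 2 ^ k * Real.sqrt r := by
      rw [Real.sqrt_mul (by positivity)]
      congr 1
      rw [show (4 : ℝ) = 2 ^ 2 by norm_num, ← pow_mul, mul_comm, pow_mul,
        Real.sqrt_sq (by positivity)]
    have e2 : c / 2 ^ k = M * (4 / (2 ^ k * Real.sqrt r)) := by
      rw [hc]; field_simp
    rw [e, e2]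
    gcongr
    rw [hM]; linarith
  choose f hfF hfx hf0 hf1 hfE using key
  set S : ℕ → X → ℝ := fun n => ∑ k ∈ Finset.range n, f k with hS
  have hSF : ∀ n, S n ∈ rf.F := fun n => rf.sum_mem _ _ fun i _ => hfF i
  have hdiff : ∀ n p, rf.E (S (n + p) - S n) (S (n + p) - S n)
      ≤ (2 * c / 2 ^ n - 2 * c / 2 ^ (n + p)) ^ 2 := by
    intro n p
    induction p with
    | zero => simp [rf.E_zero]
    | succ p ih =>
      have e : S (n + (p + 1)) - S n = (S (n + p) - S n) + f (n + p) := by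
        simp only [hS, ← add_assoc, Finset.sum_range_succ]; abel
      rw [e]
      refine (rf.E_tri (rf.sub_mem (hSF _) (hSF _)) (hfF _) ?_ (by positivity) ih
        (hfE (n + p))).trans (le_of_eq ?_)
      · rw [sub_nonneg]; gcongr
        · norm_num
        · omega
      · rw [← add_assoc, pow_succ (2 : ℝ) (n + p)]; congr 1; field_simp; ring
  have hdiff' : ∀ n p, rf.E (S (n + p) - S n) (S (n + p) - S n) ≤ (2 * c / 2 ^ n) ^ 2 := by
    intro n p
    refine (hdiff n p).trans ?_
    have h1 : 2 * c / 2 ^ (n + p) ≤ 2 * c / 2 ^ n := by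
      gcongr
      · norm_num
      · omega
    have h2 : 0 ≤ 2 * c / 2 ^ (n + p) := by positivity
    apply pow_le_pow_left₀ <;> linarith
  have hneg : ∀ u v : X → ℝ, u ∈ rf.F → v ∈ rf.F →
      rf.E (u - v) (u - v) = rf.E (v - u) (v - u) := by
    intro u v hu hv
    have e : u - v = (-1 : ℝ) • (v - u) := by ext; simp
    rw [e, rf.E_smul _ (rf.sub_mem hv hu)]; ring
  have hlim : Tendsto (fun n : ℕ => (2 * c / 2 ^ n) ^ 2) atTop (𝓝 0) := by
    have h1 : Tendsto (fun n : ℕ => (2 * c) * (1 / 2 : ℝ) ^ n) atTop (𝓝 ((2 * c) * 0)) :=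
      (tendsto_pow_atTop_nhds_zero_of_lt_one (by norm_num) (by norm_num)).const_mul _
    have h2 := h1.pow 2
    simp only [mul_zero, ne_eq, OfNat.ofNat_ne_zero, not_false_eq_true, zero_pow] at h2
    refine h2.congr fun n => ?_
    rw [one_div, inv_pow, div_eq_mul_inv]
  obtain ⟨v, hv, hvl⟩ := rf.complete S hSF (by
    intro ε hε
    obtain ⟨n0, hn0⟩ := (hlim.eventually (gt_mem_nhds hε)).exists_forall_of_atTop
    refine ⟨n0, fun m hm n hn => ?_⟩
    rcases le_total n m with hnm | hnm
    · obtain ⟨p, rfl⟩ := Nat.exists_eq_add_of_le hnm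
      exact (hdiff' n p).trans_lt (hn0 n hn)
    · obtain ⟨p, rfl⟩ := Nat.exists_eq_add_of_le hnm
      rw [hneg _ _ (hSF _) (hSF _)]
      exact (hdiff' m p).trans_lt (hn0 m hm))
  set w : X → ℝ := fun y => v y + (- v x) with hw
  have hwF : w ∈ rf.F := rf.add_const_mem hv _
  have hwS : ∀ n, rf.E (w - S n) (w - S n) ≤ rf.E (v - S n) (v - S n) := by
    intro n
    have e : w - S n = fun y => (v - S n) y + (- v x) := by
      ext y; simp only [hw, Pi.sub_apply]; ring
    rw [e]; exact rf.E_add_const (rf.sub_mem hv (hSF n)) _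
  have hSx : ∀ n, S n x = 0 := fun n => by simp [hS, hfx]
  have hwx : w x = 0 := by simp [hw]
  have hw1 : ∀ y, r ≤ dist x y → 1 ≤ w y := by
    intro y hy
    -- the annulus containing y
    obtain ⟨k, hk1, hk2⟩ : ∃ k : ℕ, (4 : ℝ) ^ k ≤ dist x y / r ∧ dist x y / r < 4 ^ (k + 1) :=
      exists_nat_pow_near (by rwa [one_le_div hr]) (by norm_num)
    rw [le_div_iff₀ hr] at hk1
    rw [div_lt_iff₀ hr, pow_succ] at hk2
    have hfk : 1 ≤ f k y := hf1 k y hk1 (by linarith)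
    by_contra hlt
    push Not at hlt
    have hdp : 0 < dist x y := lt_of_lt_of_le hr hy
    have hgap : 0 < (1 - w y) ^ 2 := by have : 0 < 1 - w y := by linarith
                                        positivity
    obtain ⟨n0, hn0⟩ := hvl ((1 - w y) ^ 2 / dist x y) (by positivity)
    have h1 := hn0 (max n0 (k + 1)) (le_max_left _ _)
    set n := max n0 (k + 1)
    have hSn : 1 ≤ S n y := by
      refine hfk.trans ?_
      simp only [hS, Finset.sum_apply]
      exact Finset.single_le_sum (f := fun i => f i y) (fun i _ => hf0 i y)
        (Finset.mem_range.2 (lt_of_lt_of_le (Nat.lt_succ_self k) (le_max_right _ _)))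
    have h2 := rf.sq_le hR (rf.sub_mem hwF (hSF n)) x y
    have h3 := (hwS n).trans_lt h1
    rw [lt_div_iff₀ hdp] at h3
    simp only [Pi.sub_apply, hwx, hSx] at h2
    nlinarith
  have hwE : rf.E w w ≤ (3 * c) ^ 2 := by
    obtain ⟨n, hn⟩ := hvl (c ^ 2) (by positivity)
    have h1 := (hwS n).trans (hn n le_rfl).le
    have h2 := hdiff' 0 n
    have e0 : S 0 = 0 := by simp [hS]
    rw [zero_add, e0, sub_zero, pow_zero, div_one] at h2
    have h3 := rf.E_tri (rf.sub_mem hwF (hSF n)) (hSF n) hcp.le (by positivity) h1 h2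
    rw [sub_add_cancel] at h3
    refine h3.trans (le_of_eq (by ring))
  have hm := rf.markov w hwF
  refine ⟨_, hm.1, by simp [hwx], fun y => ⟨le_max_left _ _, by simp⟩, fun y hy => by
    simp [hw1 y hy], hm.2.trans (hwE.trans (le_of_eq ?_))⟩
  rw [hc, mul_pow, div_pow, Real.sq_sqrt hr.le]; ring

/-- Approximation of nonnegative functions. -/
lemma regular_nonneg [CompleteSpace X] (rf : ResistanceForm X) (hR : ∀ x y : X, dist x y = rf.rmetric x y)
    (hdb : DoublingOf fun x y : X => dist x y)
    (g : X → ℝ) (hg : Continuous g) (hgc : HasCompactSupport g) (hg0 : ∀ x, 0 ≤ g x)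
    (ε : ℝ) (hε : 0 < ε) :
    ∃ u ∈ rf.F, Continuous u ∧ HasCompactSupport u ∧ ∀ x : X, |u x - g x| < ε := by
  classical
  obtain ⟨C, hC, hcut⟩ := rf.cutoff hR hdb
  have huc := hgc.uniformContinuous_of_continuous hg
  rw [Metric.uniformContinuous_iff] at huc
  obtain ⟨r, hr, hrg⟩ := huc (ε / 2) (by positivity)
  have key : ∀ z : X, ∃ φ ∈ rf.F, (∀ y, 0 ≤ φ y ∧ φ y ≤ 1) ∧ (∀ y, r ≤ dist z y → φ y = 0) ∧
      φ ⁻¹' {1} ∈ 𝓝 z := by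
    intro z
    obtain ⟨h, hF, hz, hb, h1, -⟩ := hcut z r hr
    have hm := rf.markov _ (rf.add_const_mem (rf.smul_mem (-2) hF) 2)
    refine ⟨_, hm.1, fun y => ⟨le_max_left _ _, by simp⟩, fun y hy => ?_, ?_⟩
    · simp [h1 y hy]
    · have hcont := (rf.cont hR hF).continuousAt (x := z)
      have : ∀ᶠ y in 𝓝 z, h y < 1 / 2 := hcont.eventually (gt_mem_nhds (by rw [hz]; norm_num))
      filter_upwards [this] with y hy
      have h5 : (1 : ℝ) ≤ -(2 * h y) + 2 := by linarith
      simp [h5]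
  choose φ hφF hφb hφ0 hφ1 using key
  obtain ⟨t, -, ht⟩ := hgc.isCompact.elim_nhds_subcover (fun z => φ z ⁻¹' {1}) (fun z _ => hφ1 z)
  obtain ⟨B, hB⟩ : ∃ B : ℝ, ∀ z, g z ≤ B := by
    obtain ⟨B, hB⟩ := hgc.exists_bound_of_continuous hg
    exact ⟨B, fun z => (le_abs_self _).trans (hB z)⟩
  -- finite maxima
  have hmax : ∀ s : Finset X, ∃ u ∈ rf.F, (∀ y, 0 ≤ u y ∧ u y ≤ |B|) ∧
      (∀ z ∈ s, ∀ y, g z * φ z y ≤ u y) ∧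
      (∀ y, u y = 0 ∨ ∃ z ∈ s, u y = g z * φ z y) := by
    intro s
    induction s using Finset.induction_on with
    | empty => exact ⟨0, rf.zero_mem, by simp, by simp, by simp⟩
    | insert a s ha ih =>
      obtain ⟨u, huF, hub, hu1, hu2⟩ := ih
      have hvb : ∀ y, 0 ≤ (g a • φ a) y ∧ (g a • φ a) y ≤ |B| := by
        intro y
        have h1 := hφb a y
        have h2 := hg0 a
        have h3 := (hB a).trans (le_abs_self B)
        simp only [Pi.smul_apply, smul_eq_mul]
        exact ⟨mul_nonneg h2 h1.1, by nlinarith⟩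
      refine ⟨_, rf.max_mem huF (rf.smul_mem (g a) (hφF a)) hub hvb,
        fun y => ⟨(hub y).1.trans (le_max_left _ _), max_le (hub y).2 (hvb y).2⟩, ?_, ?_⟩
      · intro z hz y
        rcases Finset.mem_insert.1 hz with rfl | hz
        · exact le_max_right _ _
        · exact (hu1 z hz y).trans (le_max_left _ _)
      · intro y
        rcases max_choice (u y) ((g a • φ a) y) with h | h
        · rw [h]
          rcases hu2 y with h' | ⟨z, hz, h'⟩
          · exact Or.inl h'
          · exact Or.inr ⟨z, Finset.mem_insert_of_mem hz, h'⟩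
        · rw [h]
          exact Or.inr ⟨a, Finset.mem_insert_self _ _, rfl⟩
  obtain ⟨u, huF, hub, hu1, hu2⟩ := hmax t
  refine ⟨u, huF, rf.cont hR huF, ?_, ?_⟩
  · refine HasCompactSupport.intro (K := ⋃ z ∈ t, closedBall z r)
      (t.isCompact_biUnion fun z _ => compact_closedBall hdb z r) fun y hy => ?_
    rcases hu2 y with h | ⟨z, hz, h⟩
    · exact h
    · have : r ≤ dist z y := by
        by_contra hlt
        push Not at hlt
        exact hy (mem_iUnion₂.2 ⟨z, hz, by rw [mem_closedBall, dist_comm]; exact hlt.le⟩)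
      rw [h, hφ0 z y this, mul_zero]
  · intro y
    have hup : u y ≤ g y + ε / 2 := by
      rcases hu2 y with h | ⟨z, hz, h⟩
      · rw [h]; have := hg0 y; positivity
      · rw [h]
        by_cases hlt : dist z y < r
        · have h1 := hrg hlt
          rw [Real.dist_eq] at h1
          have h2 := (abs_lt.1 h1).2
          have h3 := hφb z y
          have h4 := hg0 z
          nlinarith
        · rw [hφ0 z y (not_lt.1 hlt), mul_zero]; have := hg0 y; positivity
    have hlo : g y - ε / 2 ≤ u y := by
      by_cases hy : y ∈ tsupport g
      · obtain ⟨z, hz, hzy⟩ := mem_iUnion₂.1 (ht hy)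
        have hzy' : φ z y = 1 := hzy
        have hlt : dist z y < r := by
          by_contra hge
          rw [hφ0 z y (not_lt.1 hge)] at hzy'
          norm_num at hzy'
        have h1 := hrg hlt
        rw [Real.dist_eq] at h1
        have h2 := (abs_lt.1 h1).1
        have h3 := hu1 z hz y
        rw [hzy', mul_one] at h3
        linarith
      · rw [image_eq_zero_of_notMem_tsupport hy]
        have := (hub y).1; linarith
    rw [abs_lt]; constructor <;> linarith

end metric2
end ResistanceForm

/-- Under the standing assumptions (resistance metric complete, doubling
and uniformly perfect): (a) `(E,F)` is regular, i.e. `F ∩ C₀(X,R)` is dense in `C₀(X,R)`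
in the supremum norm; (b) the annulus comparable condition (ACC) holds: there are
`α > 1` and `C > 0` with `𝓡(x, B(x,r)ᶜ ∩ cl B(x,αr)) ≤ C · 𝓡(x, B(x,r)ᶜ)` for all
`x ∈ X`, `r > 0`. -/
theorem regular_and_acc {X : Type*} [MetricSpace X] [CompleteSpace X]
    (rf : ResistanceForm X) (hR : ∀ x y : X, dist x y = rf.rmetric x y)
    (hdb : DoublingOf fun x y : X => dist x y)
    (hup : UniformlyPerfectOf fun x y : X => dist x y) :
    (∀ g : X → ℝ, Continuous g → HasCompactSupport g → ∀ ε : ℝ, 0 < ε →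
      ∃ u ∈ rf.F, Continuous u ∧ HasCompactSupport u ∧ ∀ x : X, |u x - g x| < ε) ∧
    (∃ α : ℝ, 1 < α ∧ ∃ C : ℝ, 0 < C ∧ ∀ (x : X) (r : ℝ), 0 < r →
      rf.setRes {x} ((Metric.ball x r)ᶜ ∩ closure (Metric.ball x (α * r))) ≤
        ENNReal.ofReal C * rf.setRes {x} (Metric.ball x r)ᶜ) := by
  constructor
  · intro g hg hgc ε hε
    obtain ⟨u, huF, huc, hus, hu⟩ := rf.regular_nonneg hR hdb (fun x => max (g x) 0)
      (by fun_prop) (hgc.comp_left (g := fun t : ℝ => max t 0) (by simp))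
      (fun x => le_max_right _ _) (ε / 2) (by positivity)
    obtain ⟨v, hvF, hvc, hvs, hv⟩ := rf.regular_nonneg hR hdb (fun x => max (-g x) 0)
      (by fun_prop) (hgc.comp_left (g := fun t : ℝ => max (-t) 0) (by simp))
      (fun x => le_max_right _ _) (ε / 2) (by positivity)
    refine ⟨u - v, rf.sub_mem huF hvF, huc.sub hvc, ?_, fun x => ?_⟩
    · rw [sub_eq_add_neg]; exact hus.add hvs.neg
    · have h1 := abs_lt.1 (hu x)
      have h2 := abs_lt.1 (hv x)
      have h3 : max (g x) 0 - max (-g x) 0 = g x := by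
        rcases le_total (g x) 0 with h | h
        · rw [max_eq_right h, max_eq_left (by linarith)]; ring
        · rw [max_eq_left h, max_eq_right (by linarith)]; ring
      simp only [Pi.sub_apply]
      rw [abs_lt]; constructor <;> linarith [h1.1, h1.2, h2.1, h2.2]
  · obtain ⟨γ, hγ, hperf⟩ := hup
    obtain ⟨C, hC, hcut⟩ := rf.cutoff hR hdb
    have hγ0 : 0 < γ := by linarith
    refine ⟨γ, hγ, γ * C, by positivity, fun x r hr => ?_⟩
    by_cases hball : {y : X | dist x y < r} = Set.univ
    · have hem : (Metric.ball x r)ᶜ = ∅ := by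
        rw [compl_empty_iff, ← hball]
        ext y; simp [dist_comm]
      rw [hem]
      simp only [ResistanceForm.setRes, Set.not_nonempty_empty, and_false, if_false]
      rw [ENNReal.mul_top (by simpa using by positivity)]
      exact le_top
    obtain ⟨y, hy1, hy2⟩ := hperf x r hr hball
    simp only [mem_ofPred_eq, not_lt] at hy1 hy2
    have hyB : y ∈ (Metric.ball x r)ᶜ := by simpa [dist_comm] using hy2
    have hyA : y ∈ (Metric.ball x r)ᶜ ∩ closure (Metric.ball x (γ * r)) :=
      ⟨hyB, subset_closure (by rw [mem_ball, dist_comm]; exact hy1)⟩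
    obtain ⟨g, hgF, hgx, hgb, hg1, hgE⟩ := hcut x r hr
    have hne : x ≠ y := by
      rintro rfl; rw [dist_self] at hy2; linarith
    -- the cutoff function
    have hm := rf.add_const_mem (rf.smul_mem (-1) hgF) 1
    have hmE := rf.E_add_const (rf.smul_mem (-1) hgF) 1
    rw [rf.E_smul _ hgF] at hmE
    have hu1 : ∀ z ∈ ({x} : Set X), ((-1 : ℝ) • g) z + 1 = 1 := by
      rintro z rfl; simp [hgx]
    have hu0 : ∀ z ∈ (Metric.ball x r)ᶜ, ((-1 : ℝ) • g) z + 1 = 0 := by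
      intro z hz
      have : r ≤ dist x z := by simpa [dist_comm] using hz
      simp [hg1 z this]
    have hlow : ENNReal.ofReal (r / C) ≤ rf.setRes {x} (Metric.ball x r)ᶜ := by
      unfold ResistanceForm.setRes
      rw [if_pos ⟨singleton_nonempty x, ⟨y, hyB⟩⟩, if_pos ⟨_, hm, hu1, hu0⟩]
      rw [← inv_div, ENNReal.ofReal_inv_of_pos (by positivity), ENNReal.inv_le_inv]
      refine ENNReal.ofReal_le_ofReal ?_
      refine le_trans (csInf_le ⟨0, ?_⟩ ⟨_, hm, hu1, hu0, rfl⟩) ?_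
      · rintro e ⟨u, hu, -, -, rfl⟩; exact rf.nonneg u hu
      · linarith
    have hupp : rf.setRes {x} ((Metric.ball x r)ᶜ ∩ closure (Metric.ball x (γ * r))) ≤
        ENNReal.ofReal (γ * r) := by
      unfold ResistanceForm.setRes
      rw [if_pos ⟨singleton_nonempty x, ⟨y, hyA⟩⟩]
      split_ifs with hex
      · obtain ⟨u, hu, hux, huA⟩ := hex
        have hee : ENNReal.ofReal (γ * r) = (ENNReal.ofReal (γ * r)⁻¹)⁻¹ := by
          rw [ENNReal.ofReal_inv_of_pos (by positivity), inv_inv]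
        rw [hee, ENNReal.inv_le_inv]
        refine ENNReal.ofReal_le_ofReal ?_
        have h1 : (γ * r)⁻¹ ≤ (dist x y)⁻¹ := by
          have := dist_pos.2 hne
          gcongr
        refine h1.trans ?_
        rw [← rf.rdist hR hne]
        refine csInf_le_csInf ⟨0, ?_⟩ ⟨_, u, hu, hux, huA, rfl⟩ ?_
        · rintro e ⟨u, hu, -, -, rfl⟩; exact rf.nonneg u hu
        · rintro e ⟨u, hu, hux, huA, rfl⟩
          exact ⟨u, hu, hux x rfl, huA y hyA, rfl⟩
      · exact zero_le
    calc _ ≤ ENNReal.ofReal (γ * r) := hupp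
      _ = ENNReal.ofReal (γ * C) * ENNReal.ofReal (r / C) := by
        rw [← ENNReal.ofReal_mul (by positivity)]
        congr 1; field_simp
      _ ≤ _ := by gcongr
end

section
/- Let {V_n}_{n≥0} be an increasing sequence of nonempty finite sets and for each n let (E_n, ℓ(V_n)) be a resistance form on V_n with associated resistance metric R_n. Suppose that for all x, y ∈ ⋃_{n≥0} V_n with x ≠ y the limit R(x,y) := lim_{n→∞} R_n(x,y) (over all n large enough that x, y ∈ V_n) exists and is positive. Then R, extended by R(x,x)=0, is a metric on ⋃_{n≥0} V_n, and there exists a resistance form on the metric completion V_* of (⋃_{n≥0} V_n, R) whose associated resistance metric coincides with the canonical extension R_* of R to V_*. -/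
open Filter Set Metric
open scoped ENNReal Topology

/-- the unit truncation of a real number -/
noncomputable def utrunc (t : ℝ) : ℝ := max 0 (min 1 t)

lemma continuous_utrunc : Continuous utrunc := by
  unfold utrunc; fun_prop

/-- bilinear form on finitely supported functions attached to a kernel -/
noncomputable def kerForm {S : Type*} (k : S → S → ℝ) : (S →₀ ℝ) →ₗ[ℝ] (S →₀ ℝ) →ₗ[ℝ] ℝ :=
  Finsupp.linearCombination ℝ (fun x => Finsupp.linearCombination ℝ (k x))

lemma kerForm_apply {S : Type*} (k : S → S → ℝ) (c d : S →₀ ℝ) :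
    kerForm k c d = ∑ x ∈ c.support, ∑ y ∈ d.support, c x * (d y * k x y) := by
  simp [kerForm, Finsupp.linearCombination_apply, Finsupp.sum, Finset.mul_sum]

/-- the Green kernel with base point `o` -/
noncomputable def green {S : Type*} (R : S → S → ℝ) (o : S) (x y : S) : ℝ :=
  (R x o + R y o - R x y) / 2

/-- the properties of a resistance metric that are stable under pointwise limits -/
structure GoodRes {S : Type*} (R : S → S → ℝ) (o : S) : Prop where
  self : ∀ x, R x x = 0
  symm : ∀ x y, R x y = R y x
  tri : ∀ x y z, R x z ≤ R x y + R y z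
  psd : ∀ c : S →₀ ℝ, 0 ≤ kerForm (green R o) c c
  markov : ∀ (a c : S →₀ ℝ) (b : ℝ),
    (Finsupp.linearCombination ℝ (fun x => utrunc (b + kerForm (green R o) a (Finsupp.single x 1))
      - utrunc b) c) ^ 2 ≤ kerForm (green R o) a a * kerForm (green R o) c c

lemma GoodRes.of_tendsto {S : Type*} {Rn : ℕ → S → S → ℝ} {R : S → S → ℝ} {o : S}
    (h : ∀ n, GoodRes (Rn n) o) (hl : ∀ x y, Tendsto (fun n => Rn n x y) atTop (𝓝 (R x y))) :
    GoodRes R o := by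
  have hg : ∀ x y, Tendsto (fun n => green (Rn n) o x y) atTop (𝓝 (green R o x y)) := by
    intro x y
    exact (((hl x o).add (hl y o)).sub (hl x y)).div_const 2
  have hk : ∀ c d, Tendsto (fun n => kerForm (green (Rn n) o) c d) atTop
      (𝓝 (kerForm (green R o) c d)) := by
    intro c d
    simp only [kerForm_apply]
    refine tendsto_finsetSum _ fun x _ => tendsto_finsetSum _ fun y _ => ?_
    exact ((hg x y).const_mul _).const_mul _
  refine ⟨fun x => ?_, fun x y => ?_, fun x y z => ?_, fun c => ?_, fun a c b => ?_⟩
  · refine tendsto_nhds_unique (hl x x) ?_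
    simp [fun n => (h n).self x]
  · refine tendsto_nhds_unique (hl x y) ?_
    simpa only [fun n => (h n).symm x y] using hl y x
  · exact le_of_tendsto_of_tendsto' (hl x z) ((hl x y).add (hl y z)) fun n => (h n).tri x y z
  · exact ge_of_tendsto' (hk c c) fun n => (h n).psd c
  · refine le_of_tendsto_of_tendsto' (Tendsto.pow ?_ 2) ((hk a a).mul (hk c c))
      fun n => (h n).markov a c b
    simp only [Finsupp.linearCombination_apply, Finsupp.sum]
    refine tendsto_finsetSum _ fun x _ => Tendsto.const_smul ?_ _
    exact ((continuous_utrunc.tendsto _).comp ((hk a _).const_add b)).sub_const _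

lemma rmetric_eq_of_repr {Y : Type*} (rf : ResistanceForm Y) {x y : Y} (hxy : x ≠ y)
    {D : ℝ} (hmin : ∃ u ∈ rf.F, u x = 1 ∧ u y = 0 ∧ rf.E u u = D⁻¹)
    (hle : ∀ u ∈ rf.F, u x = 1 → u y = 0 → D⁻¹ ≤ rf.E u u) : rf.rmetric x y = D := by
  have : IsLeast {e : ℝ | ∃ u ∈ rf.F, u x = 1 ∧ u y = 0 ∧ rf.E u u = e} D⁻¹ := by
    refine ⟨hmin, ?_⟩
    rintro e ⟨u, hu, h1, h0, rfl⟩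
    exact hle u hu h1 h0
  rw [ResistanceForm.rmetric, if_neg hxy, this.csInf_eq, inv_inv]

lemma goodRes_finite {Y S : Type*} [Finite Y] (rf : ResistanceForm Y) (hF : rf.F = Set.univ)
    (ι : S → Y) (o : S) : GoodRes (fun x y => rf.rmetric (ι x) (ι y)) o := by
  have hm : ∀ u, u ∈ rf.F := fun u => hF ▸ Set.mem_univ u
  obtain ⟨E, hE⟩ : ∃ E : (Y → ℝ) →ₗ[ℝ] (Y → ℝ) →ₗ[ℝ] ℝ, ∀ u v, E u v = rf.E u v := by
    refine ⟨LinearMap.mk₂ ℝ rf.E (fun u v w => rf.add_left u (hm _) v (hm _) w (hm _))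
      (fun c u v => rf.smul_left c u (hm _) v (hm _)) (fun u v w => ?_) (fun c u v => ?_),
      fun u v => rfl⟩
    · rw [rf.symm _ (hm _) _ (hm _), rf.add_left _ (hm _) _ (hm _) _ (hm _),
        rf.symm _ (hm _) u (hm _), rf.symm w (hm _) u (hm _)]
    · rw [rf.symm _ (hm _) _ (hm _), rf.smul_left _ _ (hm _) _ (hm _),
        rf.symm _ (hm _) u (hm _)]; rfl
  have hsymm : ∀ u v, E u v = E v u := fun u v => by
    rw [hE, hE, rf.symm _ (hm _) _ (hm _)]
  have hnn : ∀ u, 0 ≤ E u u := fun u => by rw [hE]; exact rf.nonneg u (hm _)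
  have hCS : ∀ u v, (E u v) ^ 2 ≤ E u u * E v v := by
    intro u v
    exact LinearMap.BilinForm.apply_sq_le_of_symm E hnn ⟨fun u v => hsymm u v⟩ u v
  have hconst : ∀ (c : ℝ) v, E v (fun _ => c) = 0 := by
    intro c v
    have h0 : E (fun _ => c) (fun _ => c) = 0 := by
      rw [hE]; exact (rf.null_iff_const _ (hm _)).2 ⟨c, fun _ => rfl⟩
    have := hCS v (fun _ => c)
    rw [h0, mul_zero] at this
    exact pow_eq_zero_iff (two_ne_zero) |>.1 (le_antisymm this (sq_nonneg _))
  -- representers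
  have hrep : ∀ x : Y, ∃ g : Y → ℝ, g (ι o) = 0 ∧ ∀ v, E g v = v x - v (ι o) := by
    let T : (Y → ℝ) →ₗ[ℝ] Module.Dual ℝ (Y → ℝ) :=
      E + LinearMap.mk₂ ℝ (fun u v : Y → ℝ => u (ι o) * v (ι o))
        (fun u v w => by simp [add_mul]) (fun c u v => by simp [mul_assoc])
        (fun u v w => by simp [mul_add]) (fun c u v => by simp; ring)
    have hT : ∀ u v, T u v = E u v + u (ι o) * v (ι o) := fun u v => rfl
    have hinj : Function.Injective T := by
      rw [← LinearMap.ker_eq_bot, LinearMap.ker_eq_bot']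
      intro u hu
      have h1 : E u u + u (ι o) * u (ι o) = 0 := by rw [← hT, hu]; rfl
      have h2 := hnn u
      have h3 : E u u = 0 := by nlinarith [mul_self_nonneg (u (ι o))]
      have h4 : u (ι o) = 0 := by nlinarith [mul_self_nonneg (u (ι o))]
      rw [hE] at h3
      obtain ⟨c, hc⟩ := (rf.null_iff_const _ (hm _)).1 h3
      funext z
      simp only [Pi.zero_apply]
      rw [hc, ← hc (ι o), h4]
    have hsurj : Function.Surjective T :=
      (LinearMap.injective_iff_surjective_of_finrank_eq_finrank
        (Subspace.dual_finrank_eq).symm).1 hinj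
    intro x
    obtain ⟨g, hg⟩ := hsurj (LinearMap.proj (R := ℝ) (φ := fun _ : Y => ℝ) x
      - LinearMap.proj (R := ℝ) (φ := fun _ : Y => ℝ) (ι o))
    have hg' : ∀ v, E g v + g (ι o) * v (ι o) = v x - v (ι o) := by
      intro v; rw [← hT, hg]; rfl
    have h0 : g (ι o) = 0 := by
      have := hg' (fun _ => 1)
      rw [hconst] at this
      simpa using this
    refine ⟨g, h0, fun v => ?_⟩
    have := hg' v
    rw [h0] at this
    simpa using this
  choose g hg0 hg using hrep
  have hR : ∀ x y, rf.rmetric x y = E (g x - g y) (g x - g y) := by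
    intro x y
    by_cases hxy : x = y
    · subst hxy; simp [ResistanceForm.rmetric]
    have hd : ∀ v, E (g x - g y) v = v x - v y := by
      intro v; rw [map_sub, LinearMap.sub_apply, hg, hg]; ring
    set d := g x - g y with hdd
    have hpos : 0 < E d d := by
      refine lt_of_le_of_ne (hnn d) fun h => ?_
      obtain ⟨u, -, hu1, hu0⟩ := rf.exists_unit x y hxy
      have := hCS d u
      rw [← h, hd, hu1, hu0] at this
      norm_num at this
    refine rmetric_eq_of_repr rf hxy ⟨(E d d)⁻¹ • (d - fun _ => d y), hm _, ?_, ?_, ?_⟩ ?_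
    · simp only [Pi.smul_apply, Pi.sub_apply, smul_eq_mul]
      rw [← hd]; exact inv_mul_cancel₀ hpos.ne'
    · simp
    · rw [← hE]
      simp only [map_smul, map_sub, LinearMap.smul_apply, LinearMap.sub_apply, hconst, smul_eq_mul]
      rw [hsymm (fun _ => d y) d, hconst]
      field_simp
      simp
    · intro u _ h1 h0
      have := hCS d u
      rw [hd, h1, h0] at this
      rw [← hE, inv_le_iff_one_le_mul₀' hpos]
      linarith
  have hgg : ∀ x y, E (g x) (g y) = g y x := by
    intro x y; rw [hg, hg0, sub_zero]
  have hgo : g (ι o) = 0 := by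
    funext z
    have : E (g z) (g (ι o)) = 0 := by rw [hsymm, hg]; ring
    rw [hgg] at this; exact this
  have hgreen : ∀ x y, green (fun x y => rf.rmetric (ι x) (ι y)) o x y
      = E (g (ι x)) (g (ι y)) := by
    intro x y
    simp only [green, hR, hgo, map_sub, LinearMap.sub_apply, map_zero, LinearMap.zero_apply]
    rw [hsymm (g (ι y)) (g (ι x))]; ring
  let G : (S →₀ ℝ) →ₗ[ℝ] (Y → ℝ) := Finsupp.linearCombination ℝ (fun x => g (ι x))
  have hG : ∀ c d, kerForm (green (fun x y => rf.rmetric (ι x) (ι y)) o) c d = E (G c) (G d) := by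
    intro c d
    rw [kerForm_apply]
    simp only [G, Finsupp.linearCombination_apply, Finsupp.sum, map_sum, LinearMap.sum_apply,
      map_smul, LinearMap.smul_apply, hgreen, smul_eq_mul]
    rw [Finset.sum_comm]
    refine Finset.sum_congr rfl fun x _ => ?_
    rw [Finset.mul_sum]
    exact Finset.sum_congr rfl fun y _ => by ring
  have hGv : ∀ c v, E (G c) v = Finsupp.linearCombination ℝ (fun x => v (ι x) - v (ι o)) c := by
    intro c v
    simp only [G, Finsupp.linearCombination_apply, Finsupp.sum, map_sum, LinearMap.sum_apply,
      map_smul, LinearMap.smul_apply, hg]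
  refine ⟨fun x => ?_, fun x y => ?_, fun x y z => ?_, fun c => ?_, fun a c b => ?_⟩
  · simp [ResistanceForm.rmetric]
  · simp only [hR, map_sub, LinearMap.sub_apply]; ring
  · -- triangle inequality
    generalize ι x = x
    generalize ι y = y
    generalize ι z = z
    by_cases hxy : x = y
    · subst hxy; simp [hR]
    set d := g x - g y with hdd
    have hd : ∀ v, E d v = v x - v y := by
      intro v; rw [hdd, map_sub, LinearMap.sub_apply, hg, hg]; ring
    have hpos : 0 < E d d := by
      refine lt_of_le_of_ne (hnn d) fun h => ?_
      obtain ⟨u, -, hu1, hu0⟩ := rf.exists_unit x y hxy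
      have := hCS d u
      rw [← h, hd, hu1, hu0] at this
      norm_num at this
    set u : Y → ℝ := (E d d)⁻¹ • (d - fun _ => d y) with hu
    have hux : u x = 1 := by
      simp only [hu, Pi.smul_apply, Pi.sub_apply, smul_eq_mul]
      rw [← hd]; exact inv_mul_cancel₀ hpos.ne'
    have huy : u y = 0 := by simp [hu]
    have huv : ∀ v, E u v = (E d d)⁻¹ * (v x - v y) := by
      intro v
      have h7 : E (d - fun _ => d y) v = v x - v y := by
        rw [map_sub E, LinearMap.sub_apply, hsymm (fun _ => d y), hconst, hd, sub_zero]
      rw [hu, map_smul, LinearMap.smul_apply, h7, smul_eq_mul]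
    obtain ⟨-, hmk⟩ := rf.markov u (hm _)
    rw [← hE, ← hE] at hmk
    set w : Y → ℝ := fun x => max 0 (min 1 (u x)) with hw
    have hwx : w x = 1 := by simp [hw, hux]
    have hwy : w y = 0 := by simp [hw, huy]
    have hz : E (w - u) (w - u) = 0 := by
      refine le_antisymm ?_ (hnn _)
      simp only [map_sub, LinearMap.sub_apply]
      rw [hsymm w u, huv w, huv u, hwx, hwy, hux, huy]
      rw [huv u, hux, huy] at hmk
      linarith
    rw [hE] at hz
    obtain ⟨c, hc⟩ := (rf.null_iff_const _ (hm _)).1 hz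
    have hc0 : c = 0 := by rw [← hc y, Pi.sub_apply, hwy, huy, sub_zero]
    have h1 := hc z
    rw [hc0, Pi.sub_apply] at h1
    have h2 : 0 ≤ u z := by
      have : 0 ≤ w z := le_max_left _ _
      linarith
    have h3 : 0 ≤ d z - d y := by
      simp only [hu, Pi.smul_apply, Pi.sub_apply, smul_eq_mul] at h2
      exact (mul_nonneg_iff_of_pos_left (inv_pos.2 hpos)).1 h2
    have h4 : d z - d y = E (g z - g y) d := by
      rw [map_sub E, LinearMap.sub_apply, hg, hg]; ring
    rw [h4] at h3
    simp only [hR, hdd, map_sub, LinearMap.sub_apply] at h3 ⊢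
    rw [hsymm (g z) (g x), hsymm (g y) (g x), hsymm (g z) (g y)] at *
    linarith
  · rw [hG]; exact hnn _
  · rw [hG, hG]
    have hGo : G a (ι o) = 0 := by
      simp [G, Finsupp.linearCombination_apply, Finsupp.sum, hg0]
    set u : Y → ℝ := (fun _ => b) + G a with hu
    have h1 : ∀ x, b + kerForm (green (fun x y => rf.rmetric (ι x) (ι y)) o) a
        (Finsupp.single x 1) = u (ι x) := by
      intro x
      have h6 : G (Finsupp.single x 1) = g (ι x) := by simp [G]
      rw [hG, h6, hsymm, hg, hGo, hu, sub_zero]; rfl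
    have h2 : b = u (ι o) := by
      rw [hu, Pi.add_apply, hGo, add_zero]
    obtain ⟨-, hmk⟩ := rf.markov u (hm _)
    rw [← hE, ← hE] at hmk
    have h3 : E u u = E (G a) (G a) := by
      rw [hu]
      simp only [map_add, LinearMap.add_apply, hconst]
      rw [hsymm (fun _ => b), hconst]; ring
    have h4 := hCS (G c) (fun x => max 0 (min 1 (u x)))
    rw [hGv] at h4
    have h5 : (fun x => utrunc (b + kerForm (green (fun x y => rf.rmetric (ι x) (ι y)) o) a
        (Finsupp.single x 1)) - utrunc b) = fun x => max 0 (min 1 (u (ι x)))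
          - max 0 (min 1 (u (ι o))) := by
      funext x
      rw [h1, ← h2]; rfl
    rw [h5]
    refine h4.trans ?_
    rw [mul_comm]
    exact mul_le_mul_of_nonneg_right (hmk.trans h3.le) (hnn _)

lemma exists_hilbert.{u} {S : Type u} (k : S → S → ℝ) (hk : ∀ x y, k x y = k y x)
    (hpsd : ∀ c, 0 ≤ kerForm k c c) :
    ∃ (H : Type u) (_ : NormedAddCommGroup H) (_ : InnerProductSpace ℝ H) (_ : CompleteSpace H)
      (Ψ : (S →₀ ℝ) →ₗ[ℝ] H), DenseRange Ψ ∧ ∀ c d, inner ℝ (Ψ c) (Ψ d) = kerForm k c d := by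
  let core : PreInnerProductSpace.Core ℝ (S →₀ ℝ) :=
    { inner := fun c d => kerForm k c d
      conj_inner_symm := by
        intro c d
        simp only [kerForm_apply, conj_trivial]
        rw [Finset.sum_comm]
        refine Finset.sum_congr rfl fun x _ => Finset.sum_congr rfl fun y _ => ?_
        rw [hk y x]; ring
      re_inner_nonneg := by
        intro c; exact hpsd c
      add_left := by intro x y z; simp
      smul_left := by intro x y z; simp }
  let _ : SeminormedAddCommGroup (S →₀ ℝ) :=
    @InnerProductSpace.Core.toSeminormedAddCommGroup ℝ (S →₀ ℝ) _ _ _ core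
  let _ : InnerProductSpace ℝ (S →₀ ℝ) := InnerProductSpace.ofCore core
  refine ⟨UniformSpace.Completion (S →₀ ℝ), inferInstance, inferInstance, inferInstance,
    (UniformSpace.Completion.toComplL (𝕜 := ℝ) (E := S →₀ ℝ)).toLinearMap, ?_, ?_⟩
  · exact UniformSpace.Completion.denseRange_coe
  · intro c d
    exact UniformSpace.Completion.inner_coe c d

lemma exists_repr {S H : Type*} [NormedAddCommGroup H] [InnerProductSpace ℝ H] [CompleteSpace H]
    (Ψ : (S →₀ ℝ) →ₗ[ℝ] H) (f : S → ℝ) (C : ℝ) (hC : 0 ≤ C)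
    (hf : ∀ c, (Finsupp.linearCombination ℝ f c) ^ 2 ≤ C ^ 2 * ‖Ψ c‖ ^ 2) :
    ∃ h : H, ‖h‖ ≤ C ∧ ∀ x, inner ℝ (Ψ (Finsupp.single x 1)) h = f x := by
  have hb : ∀ c, |Finsupp.linearCombination ℝ f c| ≤ C * ‖Ψ c‖ := by
    intro c
    refine abs_le_of_sq_le_sq ?_ (by positivity)
    rw [mul_pow]; exact hf c
  obtain ⟨s, hs⟩ := LinearMap.exists_rightInverse_of_surjective Ψ.rangeRestrict
    (LinearMap.range_rangeRestrict Ψ)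
  have hs' : ∀ z : LinearMap.range Ψ, Ψ (s z) = z := by
    intro z
    have := LinearMap.congr_fun hs z
    exact congrArg Subtype.val this
  let F : StrongDual ℝ (LinearMap.range Ψ) :=
    LinearMap.mkContinuous ((Finsupp.linearCombination ℝ f).comp s) C (by
      intro z
      have := hb (s z)
      rw [hs'] at this
      exact this)
  obtain ⟨G, hG, hGn⟩ := exists_extension_norm_eq (LinearMap.range Ψ) F
  refine ⟨(InnerProductSpace.toDual ℝ H).symm G, ?_, fun x => ?_⟩
  · rw [LinearIsometryEquiv.norm_map, hGn]
    exact LinearMap.mkContinuous_norm_le _ hC _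
  · rw [real_inner_comm, InnerProductSpace.toDual_symm_apply]
    have h1 := hG ⟨Ψ (Finsupp.single x 1), LinearMap.mem_range_self _ _⟩
    have h2 := hb (s ⟨Ψ (Finsupp.single x 1), LinearMap.mem_range_self _ _⟩ - Finsupp.single x 1)
    rw [map_sub Ψ, hs', sub_self, norm_zero, mul_zero, map_sub] at h2
    have h3 := abs_eq_zero.1 (le_antisymm h2 (abs_nonneg _))
    simp only [Finsupp.linearCombination_single, one_smul] at h3
    refine h1.trans ?_
    exact sub_eq_zero.1 h3

lemma exists_form {S : Type*} [MetricSpace S] (o : S) (hR : GoodRes (fun x y : S => dist x y) o) :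
    ∃ rf : ResistanceForm (UniformSpace.Completion S), ∀ p q, rf.rmetric p q = dist p q := by
  obtain ⟨H, _, _, _, Ψ, hΨd, hΨ⟩ := exists_hilbert (green (fun x y : S => dist x y) o)
    (fun x y => by simp only [green, dist_comm]; ring) hR.psd
  have hΨn : ∀ c, ‖Ψ c‖ ^ 2 = kerForm (green (fun x y : S => dist x y) o) c c := by
    intro c; rw [← hΨ, real_inner_self_eq_norm_sq]
  set φ : S → H := fun x => Ψ (Finsupp.single x 1) with hφ
  have hφi : ∀ x y, inner ℝ (φ x) (φ y) = green (fun x y : S => dist x y) o x y := by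
    intro x y; simp [hφ, hΨ, kerForm]
  have hφd : ∀ x y, ‖φ x - φ y‖ ^ 2 = dist x y := by
    intro x y
    rw [norm_sub_sq_real, ← real_inner_self_eq_norm_sq, ← real_inner_self_eq_norm_sq, hφi, hφi, hφi]
    simp only [green, dist_self]; ring
  have hφu : UniformContinuous φ := by
    rw [Metric.uniformContinuous_iff]
    intro ε hε
    refine ⟨ε ^ 2, by positivity, fun {x y} hxy => ?_⟩
    rw [← hφd] at hxy
    rw [dist_eq_norm]
    exact lt_of_pow_lt_pow_left₀ 2 hε.le hxy
  let Φ : UniformSpace.Completion S → H := UniformSpace.Completion.extension φ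
  have hΦc : Continuous Φ := UniformSpace.Completion.continuous_extension
  have hΦφ : ∀ x : S, Φ x = φ x := fun x => UniformSpace.Completion.extension_coe hφu x
  have hΦd : ∀ p q, ‖Φ p - Φ q‖ ^ 2 = dist p q := by
    intro p q
    refine UniformSpace.Completion.induction_on₂ p q
      (isClosed_eq (by fun_prop) (by fun_prop)) fun x y => ?_
    rw [hΦφ, hΦφ, hφd, UniformSpace.Completion.dist_eq]
  have hΦo : Φ (o : UniformSpace.Completion S) = 0 := by
    rw [hΦφ, ← inner_self_eq_zero (𝕜 := ℝ), hφi]; simp [green]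
  have hsep : ∀ h : H, (∀ p, inner ℝ (Φ p) h = 0) → h = 0 := by
    intro h hh
    have h1 : ∀ c, inner ℝ (Ψ c) h = 0 := by
      intro c
      induction c using Finsupp.induction_linear with
      | zero => simp
      | add a b ha hb => rw [map_add, inner_add_left, ha, hb, add_zero]
      | single x r =>
        have h2 : Finsupp.single x r = r • Finsupp.single x (1 : ℝ) := by simp
        have h3 := hh x
        rw [hΦφ] at h3
        rw [h2, map_smul, inner_smul_left, h3, mul_zero]
    have h4 : ∀ z : H, inner ℝ z h = 0 := fun z =>
      hΨd.induction_on (p := fun z => inner ℝ z h = 0) z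
        (isClosed_eq (by fun_prop) (by fun_prop)) h1
    exact inner_self_eq_zero.1 (h4 h)
  have huniq : ∀ (h h' : H) (c c' : ℝ), (∀ p, inner ℝ (Φ p) h + c = inner ℝ (Φ p) h' + c') →
      h = h' := by
    intro h h' c c' hh
    have h0 := hh o
    rw [hΦo, inner_zero_left, inner_zero_left] at h0
    refine sub_eq_zero.1 (hsep _ fun p => ?_)
    rw [inner_sub_right]
    linarith [hh p]
  let F : Set (UniformSpace.Completion S → ℝ) := {u | ∃ (h : H) (c : ℝ), ∀ p, u p = inner ℝ (Φ p) h + c}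
  obtain ⟨η, hη⟩ : ∃ η : (UniformSpace.Completion S → ℝ) → H, ∀ u ∈ F, ∃ c : ℝ, ∀ p,
      u p = inner ℝ (Φ p) (η u) + c := by
    classical
    refine ⟨fun u => if hu : u ∈ F then hu.choose else 0, fun u hu => ?_⟩
    simp only [dif_pos hu]
    exact hu.choose_spec
  have hηe : ∀ (u : UniformSpace.Completion S → ℝ) (h : H) (c : ℝ),
      (∀ p, u p = inner ℝ (Φ p) h + c) → η u = h := by
    intro u h c hu
    obtain ⟨c', hc'⟩ := hη u ⟨h, c, hu⟩
    exact huniq _ _ c' c fun p => by rw [← hc', ← hu]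
  have hadd : ∀ u ∈ F, ∀ v ∈ F, u + v ∈ F ∧ η (u + v) = η u + η v := by
    intro u hu v hv
    obtain ⟨c, hc⟩ := hη u hu
    obtain ⟨d, hd⟩ := hη v hv
    have h1 : ∀ p, (u + v) p = inner ℝ (Φ p) (η u + η v) + (c + d) := by
      intro p; rw [Pi.add_apply, hc, hd, inner_add_right]; ring
    exact ⟨⟨_, _, h1⟩, hηe _ _ _ h1⟩
  have hsmul : ∀ (r : ℝ), ∀ u ∈ F, r • u ∈ F ∧ η (r • u) = r • η u := by
    intro r u hu
    obtain ⟨c, hc⟩ := hη u hu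
    have h1 : ∀ p, (r • u) p = inner ℝ (Φ p) (r • η u) + (r * c) := by
      intro p; rw [Pi.smul_apply, hc, inner_smul_right, smul_eq_mul]; ring
    exact ⟨⟨_, _, h1⟩, hηe _ _ _ h1⟩
  have hsub : ∀ u ∈ F, ∀ v ∈ F, η (u - v) = η u - η v := by
    intro u hu v hv
    have h1 : u - v = u + (-1 : ℝ) • v := by rw [neg_one_smul, sub_eq_add_neg]
    rw [h1, (hadd _ hu _ (hsmul _ _ hv).1).2, (hsmul _ _ hv).2, neg_one_smul, sub_eq_add_neg]
  have hconst : ∀ c : ℝ, (fun _ => c) ∈ F ∧ η (fun _ => c) = 0 := by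
    intro c
    have h1 : ∀ p : UniformSpace.Completion S, c = inner ℝ (Φ p) (0 : H) + c := by
      intro p; simp
    exact ⟨⟨_, _, h1⟩, hηe _ _ _ h1⟩
  have hdiff : ∀ u ∈ F, ∀ p q, u p - u q = inner ℝ (Φ p - Φ q) (η u) := by
    intro u hu p q
    obtain ⟨c, hc⟩ := hη u hu
    rw [hc, hc, inner_sub_left]; ring
  have hlow : ∀ p q, p ≠ q → ∀ u ∈ F, u p = 1 → u q = 0 →
      (dist p q)⁻¹ ≤ inner ℝ (η u) (η u) := by
    intro p q hpq u hu h1 h0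
    have h2 := hdiff u hu p q
    rw [h1, h0, sub_zero] at h2
    have h3 := real_inner_mul_inner_self_le (Φ p - Φ q) (η u)
    rw [← h2, real_inner_self_eq_norm_sq (Φ p - Φ q), hΦd] at h3
    rw [inv_le_iff_one_le_mul₀' (dist_pos.2 hpq)]
    linarith
  have hunit : ∀ p q, p ≠ q → ∃ u ∈ F, u p = 1 ∧ u q = 0 ∧ inner ℝ (η u) (η u) = (dist p q)⁻¹ := by
    intro p q hpq
    have hpos := dist_pos.2 hpq
    set d := Φ p - Φ q with hd
    have h1 : ∀ z, (fun z => inner ℝ (Φ z) ((dist p q)⁻¹ • d) + -(inner ℝ (Φ q) ((dist p q)⁻¹ • d))) z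
        = inner ℝ (Φ z) ((dist p q)⁻¹ • d) + -(inner ℝ (Φ q) ((dist p q)⁻¹ • d)) := fun z => rfl
    refine ⟨_, ⟨_, _, h1⟩, ?_, ?_, ?_⟩
    · show inner ℝ (Φ p) ((dist p q)⁻¹ • d) + -(inner ℝ (Φ q) ((dist p q)⁻¹ • d)) = 1
      rw [← sub_eq_add_neg, ← inner_sub_left, ← hd, inner_smul_right, real_inner_self_eq_norm_sq,
        hΦd, inv_mul_cancel₀ hpos.ne']
    · show inner ℝ (Φ q) ((dist p q)⁻¹ • d) + -(inner ℝ (Φ q) ((dist p q)⁻¹ • d)) = 0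
      ring
    · rw [hηe _ _ _ h1, real_inner_smul_left, inner_smul_right, real_inner_self_eq_norm_sq,
        hΦd, inv_mul_cancel₀ hpos.ne', mul_one]
  -- the Markov property
  have hmk0 : ∀ (b : ℝ) (c : S →₀ ℝ) (h : H),
      (Finsupp.linearCombination ℝ (fun x => utrunc (b + inner ℝ (φ x) h) - utrunc b) c) ^ 2
        ≤ ‖h‖ ^ 2 * ‖Ψ c‖ ^ 2 := by
    intro b c h
    refine hΨd.induction_on (p := fun h =>
      (Finsupp.linearCombination ℝ (fun x => utrunc (b + inner ℝ (φ x) h) - utrunc b) c) ^ 2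
        ≤ ‖h‖ ^ 2 * ‖Ψ c‖ ^ 2) h ?_ ?_
    · refine isClosed_le ?_ (by fun_prop)
      simp only [Finsupp.linearCombination_apply, Finsupp.sum]
      refine Continuous.pow (continuous_finsetSum _ fun x _ => ?_) 2
      refine Continuous.const_smul ?_ (c x)
      exact (continuous_utrunc.comp (by fun_prop)).sub continuous_const
    · intro a
      have := hR.markov a c b
      rw [← hΨn, ← hΨn] at this
      simp only [← hΨ] at this
      simpa only [hφ, real_inner_comm] using this
  have hmk : ∀ u ∈ F, (fun x => max 0 (min 1 (u x))) ∈ F ∧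
      inner ℝ (η fun x => max 0 (min 1 (u x))) (η fun x => max 0 (min 1 (u x)))
        ≤ inner ℝ (η u) (η u) := by
    intro u hu
    obtain ⟨b, hb⟩ := hη u hu
    obtain ⟨h', hn, hh'⟩ := exists_repr Ψ
      (fun x => utrunc (b + inner ℝ (φ x) (η u)) - utrunc b) ‖η u‖ (norm_nonneg _)
      (fun c => hmk0 b c (η u))
    have h1 : ∀ p, (fun x => max 0 (min 1 (u x))) p = inner ℝ (Φ p) h' + utrunc b := by
      intro p
      show utrunc (u p) = _
      rw [hb]
      refine UniformSpace.Completion.induction_on p (isClosed_eq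
        (continuous_utrunc.comp (by fun_prop)) (by fun_prop)) fun x => ?_
      rw [hΦφ]
      have := hh' x
      simp only [hφ] at this ⊢
      rw [this, add_comm b]; ring
    refine ⟨⟨_, _, h1⟩, ?_⟩
    rw [hηe _ _ _ h1, real_inner_self_eq_norm_sq, real_inner_self_eq_norm_sq]
    gcongr
  let rf : ResistanceForm (UniformSpace.Completion S) :=
    { F := F
      E := fun u v => inner ℝ (η u) (η v)
      zero_mem := (hconst 0).1
      add_mem := fun hu hv => (hadd _ hu _ hv).1
      smul_mem := fun c u hu => (hsmul c u hu).1
      const_mem := fun c => (hconst c).1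
      symm := fun u _ v _ => real_inner_comm _ _
      add_left := fun u hu v hv w _ => by rw [(hadd u hu v hv).2, inner_add_left]
      smul_left := fun c u hu v _ => by rw [(hsmul c u hu).2, real_inner_smul_left]
      nonneg := fun u _ => real_inner_self_nonneg
      null_iff_const := by
        intro u hu
        constructor
        · intro h
          obtain ⟨c, hc⟩ := hη u hu
          refine ⟨c, fun p => ?_⟩
          rw [hc, inner_self_eq_zero.1 h, inner_zero_right, zero_add]
        · rintro ⟨c, hc⟩
          have : u = fun _ => c := funext hc
          rw [this, (hconst c).2, inner_zero_left]
      complete := by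
        intro u hu hc
        have hcau : CauchySeq (fun n => η (u n)) := by
          rw [Metric.cauchySeq_iff]
          intro ε hε
          obtain ⟨N, hN⟩ := hc (ε ^ 2) (by positivity)
          refine ⟨N, fun m hm n hn => ?_⟩
          have := hN m hm n hn
          rw [hsub _ (hu _) _ (hu _), real_inner_self_eq_norm_sq] at this
          rw [dist_eq_norm]
          exact lt_of_pow_lt_pow_left₀ 2 hε.le this
        obtain ⟨h, hh⟩ := cauchySeq_tendsto_of_complete hcau
        have h1 : ∀ p, (fun p => inner ℝ (Φ p) h + 0) p = inner ℝ (Φ p) h + 0 := fun p => rfl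
        have hv : (fun p => inner ℝ (Φ p) h + 0) ∈ F := ⟨_, _, h1⟩
        refine ⟨_, hv, fun ε hε => ?_⟩
        rw [Metric.tendsto_atTop] at hh
        obtain ⟨N, hN⟩ := hh (Real.sqrt ε) (Real.sqrt_pos.2 hε)
        refine ⟨N, fun n hn => ?_⟩
        have := hN n hn
        rw [dist_comm, dist_eq_norm] at this
        rw [hsub _ hv _ (hu _), hηe _ _ _ h1, real_inner_self_eq_norm_sq]
        exact (Real.lt_sqrt (norm_nonneg _)).1 this
      sep := by
        intro p q hpq
        obtain ⟨u, hu, h1, h0, -⟩ := hunit p q hpq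
        exact ⟨u, hu, by rw [h1, h0]; exact one_ne_zero⟩
      exists_unit := by
        intro p q hpq
        obtain ⟨u, hu, h1, h0, -⟩ := hunit p q hpq
        exact ⟨u, hu, h1, h0⟩
      inf_pos := by
        intro p q hpq
        have hl : IsLeast {e : ℝ | ∃ u ∈ F, u p = 1 ∧ u q = 0 ∧ inner ℝ (η u) (η u) = e}
            (dist p q)⁻¹ := by
          refine ⟨hunit p q hpq, ?_⟩
          rintro e ⟨u, hu, h1, h0, rfl⟩
          exact hlow p q hpq u hu h1 h0
        rw [hl.csInf_eq]
        exact inv_pos.2 (dist_pos.2 hpq)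
      markov := hmk }
  refine ⟨rf, fun p q => ?_⟩
  by_cases hpq : p = q
  · subst hpq; simp [ResistanceForm.rmetric]
  · exact rmetric_eq_of_repr rf hpq (hunit p q hpq) (hlow p q hpq)

/-- Let `{V_n}` be an increasing sequence of nonempty finite sets with
resistance forms `(E_n, ℓ(V_n))` (full domain) whose resistance metrics `R_n(x,y)`
converge, for all `x ≠ y` in `⋃_n V_n`, to a positive limit `L(x,y)`.  Then `L`
(extended by `L(x,x)=0`) is a metric on `⋃_n V_n`, and there is a resistance form on the
metric completion `V_*` of `(⋃_n V_n, L)` whose resistance metric is the canonical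
extension of `L` to `V_*` (the distance of the completion). -/
theorem exists_resistanceForm_on_completion {X : Type*}
    (V : ℕ → Finset X) (hmono : Monotone V) (hne : ∀ n, (V n).Nonempty)
    (rfn : (n : ℕ) → ResistanceForm (V n)) (hFn : ∀ n, (rfn n).F = Set.univ)
    (L : X → X → ℝ)
    (hlim : ∀ x y : X, x ∈ (⋃ n, (V n : Set X)) → y ∈ (⋃ n, (V n : Set X)) → x ≠ y →
      0 < L x y ∧ ∀ ε : ℝ, 0 < ε → ∃ N : ℕ, ∀ n ≥ N, ∀ (hx : x ∈ V n) (hy : y ∈ V n),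
        |(rfn n).rmetric ⟨x, hx⟩ ⟨y, hy⟩ - L x y| < ε)
    (hdiag : ∀ x : X, L x x = 0) :
    ∃ m : MetricSpace (⋃ n, (V n : Set X) : Set X),
      (∀ p q : (⋃ n, (V n : Set X) : Set X), @dist _ m.toDist p q = L p.1 q.1) ∧
      (letI := m
       ∃ rf : ResistanceForm (UniformSpace.Completion (⋃ n, (V n : Set X) : Set X)),
         ∀ p q : UniformSpace.Completion (⋃ n, (V n : Set X) : Set X),
           rf.rmetric p q = dist p q) := by
  classical
  obtain ⟨o0, ho0⟩ := hne 0
  let S : Type _ := (⋃ n, (V n : Set X) : Set X)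
  let o : S := ⟨o0, Set.mem_iUnion.2 ⟨0, ho0⟩⟩
  let ι : (n : ℕ) → S → V n := fun n x =>
    if h : x.1 ∈ V n then ⟨x.1, h⟩ else ⟨o0, hmono (Nat.zero_le n) ho0⟩
  have hgood : GoodRes (fun x y : S => L x.1 y.1) o := by
    refine GoodRes.of_tendsto (fun n => goodRes_finite (rfn n) (hFn n) (ι n) o) ?_
    intro x y
    by_cases hxy : x = y
    · subst hxy
      simp [ResistanceForm.rmetric, hdiag]
    obtain ⟨nx, hnx⟩ := Set.mem_iUnion.1 x.2
    obtain ⟨ny, hny⟩ := Set.mem_iUnion.1 y.2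
    rw [Metric.tendsto_atTop]
    intro ε hε
    obtain ⟨N, hN⟩ := (hlim x.1 y.1 x.2 y.2 (fun h => hxy (Subtype.ext h))).2 ε hε
    refine ⟨max N (max nx ny), fun n hn => ?_⟩
    have hx : x.1 ∈ V n := hmono (by omega) hnx
    have hy : y.1 ∈ V n := hmono (by omega) hny
    have := hN n (by omega) hx hy
    simp only [ι, dif_pos hx, dif_pos hy, Real.dist_eq]
    exact this
  let m : MetricSpace S :=
    { dist := fun x y => L x.1 y.1
      dist_self := hgood.self
      dist_comm := hgood.symm
      dist_triangle := hgood.tri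
      eq_of_dist_eq_zero := by
        intro x y h
        by_contra hxy
        exact (hlim x.1 y.1 x.2 y.2 (fun h => hxy (Subtype.ext h))).1.ne' h }
  exact ⟨m, fun p q => rfl, exists_form o hgood⟩
end
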